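/- Let F be a field, Ω a separable closure of F, and E, K finite intermediate extensions of Ω/F with gcd([E:F], [K:F]) = 1. Then every automorphism σ ∈ Aut(Ω/F) can be written as σ = τ∘ρ where τ ∈ Aut(Ω/E) fixes E pointwise and ρ ∈ Aut(Ω/K) fixes K pointwise; that is, Aut(Ω/F) = Aut(Ω/E)·Aut(Ω/K) as a setwise product of subgroups. -/

import Mathlib

/-- If two subgroups have coprime indices, the first one finite, their product is the whole group. -/
theorem Subgroup.exists_mul_eq_of_coprime_index {G : Type*} [Group G] {H K : Subgroup G}
    (hH : H.index ≠ 0) (hcop : Nat.Coprime H.index K.index) (g : G) :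
    ∃ h ∈ H, ∃ k ∈ K, g = h * k := by
  have hdvd : H.index ∣ H.relIndex K := by
    refine hcop.dvd_of_dvd_mul_right ?_
    rw [← inf_relIndex_right, relIndex_mul_index inf_le_right]
    exact index_dvd_of_le inf_le_left
  have hle : H.index ≤ H.relIndex K :=
    Nat.le_of_dvd (Nat.pos_of_ne_zero fun h0 => hH (index_eq_zero_of_relIndex_eq_zero h0)) hdvd
  have hstab : MulAction.stabilizer K ((1 : G) : G ⧸ H) = H.subgroupOf K := by
    ext k
    change (((k : G) * 1 : G) : G ⧸ H) = ((1 : G) : G ⧸ H) ↔ (k : G) ∈ H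
    rw [QuotientGroup.eq, mul_one, mul_one, inv_mem_iff]
  have : H.FiniteIndex := ⟨hH⟩
  have horbit : MulAction.orbit K ((1 : G) : G ⧸ H) = Set.univ := by
    refine Set.eq_of_subset_of_ncard_le (Set.subset_univ _) ?_
    rw [← MulAction.index_stabilizer, hstab, Set.ncard_univ]
    exact hle
  obtain ⟨k, hk⟩ : ((g⁻¹ : G) : G ⧸ H) ∈ MulAction.orbit K ((1 : G) : G ⧸ H) :=
    horbit ▸ Set.mem_univ _
  have hk' : (((k : G) * 1 : G) : G ⧸ H) = ((g⁻¹ : G) : G ⧸ H) := hk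
  rw [eq_comm, QuotientGroup.eq, inv_inv, mul_one] at hk'
  exact ⟨g * k, hk', (k : G)⁻¹, K.inv_mem k.2, by group⟩

/-- **Coprime-degree decomposition of the absolute Galois group.**
Let `Ω` be a separable closure of `F` and `E`, `K` finite intermediate extensions of `Ω/F`
with coprime degrees. Then every `σ ∈ Aut(Ω/F)` factors as `σ = τ ∘ ρ` with
`τ ∈ Aut(Ω/E)` and `ρ ∈ Aut(Ω/K)`; i.e. `Aut(Ω/F) = Aut(Ω/E) · Aut(Ω/K)`. -/
theorem galoisGroup_eq_fixing_mul_fixing_of_coprime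
    (F Ω : Type*) [Field F] [Field Ω] [Algebra F Ω] [IsSepClosure F Ω]
    (E K : IntermediateField F Ω)
    [FiniteDimensional F ↥E] [FiniteDimensional F ↥K]
    (hcop : Nat.Coprime (Module.finrank F ↥E) (Module.finrank F ↥K))
    (σ : Ω ≃ₐ[F] Ω) :
    ∃ τ ∈ E.fixingSubgroup, ∃ ρ ∈ K.fixingSubgroup, σ = τ * ρ := by
  have : IsGalois F Ω := IsSepClosure.isGalois
  have hE := E.finrank_eq_fixingSubgroup_index
  have hK := K.finrank_eq_fixingSubgroup_index
  exact Subgroup.exists_mul_eq_of_coprime_index (hE ▸ Module.finrank_pos.ne') (hE ▸ hK ▸ hcop) σ
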